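/- arXiv:2507.00250 — 2 statements merged into one kernel-verified Lean document; each statement's English description precedes it below -/
import Mathlib

section
/- Let Ω ⊆ ℝ² satisfy property (i), let K = Ω^◇ be its antipolar, let ω ∈ K, and let γ : (−1,1) → ℝ² be a continuously differentiable curve with γ(0) = ω and γ′(0) ∉ {λω : λ ∈ ℝ}. If there exists δ > 0 such that for every α ∈ (0,δ) one has (1−α)ω ∈ K, γ(−α) ∈ K and γ(α) ∈ K, then ω ∈ int K. Conversely, if for some curve γ of the above type no such δ > 0 exists, then ω ∈ ∂K. -/
open scoped Pointwise
open Set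

/-- The antipolar of a set `Ω ⊆ ℝ²`:
`Ω^◇ = {(p,q) : p·x − q·y ≥ 1 for all (x,y) ∈ Ω}`. -/
def antipolar (Ω : Set (ℝ × ℝ)) : Set (ℝ × ℝ) :=
  {pq | ∀ xy ∈ Ω, 1 ≤ pq.1 * xy.1 - pq.2 * xy.2}

/-- Property (i): `Ω` is nonempty, convex, closed, does not contain the origin,
and has the ray property `λΩ ⊆ Ω` for every `λ > 1`. -/
def PropI (Ω : Set (ℝ × ℝ)) : Prop :=
  Ω.Nonempty ∧ Convex ℝ Ω ∧ IsClosed Ω ∧ (0 : ℝ × ℝ) ∉ Ω ∧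
    ∀ c : ℝ, 1 < c → c • Ω ⊆ Ω

/-- Points of the antipolar on both sides of the line `ℝω`, together with `rω`, `r < 1`,
force `ω` to be an interior point. -/
theorem antipolar_interior_aux (Ω : Set (ℝ × ℝ)) (ω P Q : ℝ × ℝ) (r : ℝ) (hr : r < 1)
    (hn : 0 < ω.1 ^ 2 + ω.2 ^ 2)
    (hrω : r • ω ∈ antipolar Ω) (hω : ω ∈ antipolar Ω)
    (hP : P ∈ antipolar Ω) (hQ : Q ∈ antipolar Ω)
    (hDP : 0 < ω.1 * P.2 - ω.2 * P.1) (hDQ : ω.1 * Q.2 - ω.2 * Q.1 < 0) :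
    ω ∈ interior (antipolar Ω) := by
  obtain ⟨c1, hc1, hc1'⟩ : ∃ c : ℝ, 0 ≤ c ∧
      P.1 * ω.1 + P.2 * ω.2 ≤ c * (ω.1 * P.2 - ω.2 * P.1) := by
    refine ⟨|P.1 * ω.1 + P.2 * ω.2| / (ω.1 * P.2 - ω.2 * P.1), by positivity, ?_⟩
    rw [div_mul_cancel₀ _ hDP.ne']
    exact le_abs_self _
  obtain ⟨c2, hc2, hc2'⟩ : ∃ c : ℝ, 0 ≤ c ∧
      Q.1 * ω.1 + Q.2 * ω.2 ≤ c * -(ω.1 * Q.2 - ω.2 * Q.1) := by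
    have h : 0 < -(ω.1 * Q.2 - ω.2 * Q.1) := by linarith
    refine ⟨|Q.1 * ω.1 + Q.2 * ω.2| / -(ω.1 * Q.2 - ω.2 * Q.1), by positivity, ?_⟩
    rw [div_mul_cancel₀ _ h.ne']
    exact le_abs_self _
  rw [mem_interior]
  refine ⟨{p | (ω.1 ^ 2 + ω.2 ^ 2) * r <
    p.1 * ω.1 + p.2 * ω.2 - (c1 + c2) * |ω.1 * p.2 - ω.2 * p.1|}, ?_, ?_, ?_⟩
  · intro p hp xy hxy
    simp only [mem_setOf_eq] at hp
    have h0 := hω xy hxy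
    have h1 := hrω xy hxy
    have h2 := hP xy hxy
    have h3 := hQ xy hxy
    simp only [Prod.smul_fst, Prod.smul_snd, smul_eq_mul] at h1
    set t := ω.1 * xy.1 - ω.2 * xy.2 with ht
    set u := -ω.2 * xy.1 - ω.1 * xy.2 with hu
    set n := ω.1 ^ 2 + ω.2 ^ 2 with hn'
    have key : ∀ p : ℝ × ℝ, n * (p.1 * xy.1 - p.2 * xy.2) =
        (p.1 * ω.1 + p.2 * ω.2) * t + (ω.1 * p.2 - ω.2 * p.1) * u := by
      intro p; simp only [hn', ht, hu]; ring
    have hrt : 1 ≤ r * t := by rw [ht]; linarith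
    have htp : 0 < t := by linarith
    have kP := key P
    have kQ := key Q
    have kp := key p
    have hu1 : -(c1 * t) ≤ u := by
      have a1 : 0 < n * (P.1 * xy.1 - P.2 * xy.2) := mul_pos hn (by linarith)
      have a2 := mul_le_mul_of_nonneg_right hc1' htp.le
      have a3 : 0 < (ω.1 * P.2 - ω.2 * P.1) * (c1 * t + u) := by linarith
      have := (mul_pos_iff_of_pos_left hDP).1 a3
      linarith
    have hu2 : u ≤ c2 * t := by
      have a1 : 0 < n * (Q.1 * xy.1 - Q.2 * xy.2) := mul_pos hn (by linarith)
      have a2 := mul_le_mul_of_nonneg_right hc2' htp.le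
      have a3 : 0 < -(ω.1 * Q.2 - ω.2 * Q.1) * (c2 * t - u) := by linarith
      have := (mul_pos_iff_of_pos_left (by linarith)).1 a3
      linarith
    have habs : |u| ≤ (c1 + c2) * t := by
      have b1 := mul_nonneg hc1 htp.le
      have b2 := mul_nonneg hc2 htp.le
      rw [abs_le]; constructor <;> linarith
    set d := ω.1 * p.2 - ω.2 * p.1
    have e1 : -(|d| * ((c1 + c2) * t)) ≤ d * u := by
      have := neg_abs_le (d * u)
      rw [abs_mul] at this
      have := mul_le_mul_of_nonneg_left habs (abs_nonneg d)
      linarith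
    have e2 := mul_le_mul_of_nonneg_right hp.le htp.le
    have e3 := mul_le_mul_of_nonneg_left hrt hn.le
    have e4 : n * 1 ≤ n * (p.1 * xy.1 - p.2 * xy.2) := by linarith
    exact le_of_mul_le_mul_left e4 hn
  · exact isOpen_lt (by fun_prop) (by fun_prop)
  · simp only [mem_setOf_eq]
    have : ω.1 * ω.2 - ω.2 * ω.1 = 0 := by ring
    rw [this, abs_zero]
    nlinarith

/-- Interior criterion for points of the antipolar `K = Ω^◇` along a `C¹`
curve `γ` through `ω ∈ K` transversal to the ray `ℝω`: if for some `δ > 0`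
and all `α ∈ (0,δ)` the points `(1−α)ω`, `γ(−α)`, `γ(α)` all lie in `K`, then
`ω ∈ int K`; and if no such `δ` exists, `ω ∈ ∂K`. -/
theorem antipolar_interior_criterion (Ω : Set (ℝ × ℝ)) (hΩ : PropI Ω)
    (ω : ℝ × ℝ) (hω : ω ∈ antipolar Ω)
    (γ : ℝ → ℝ × ℝ) (hγ : ContDiffOn ℝ 1 γ (Ioo (-1 : ℝ) 1))
    (hγ0 : γ 0 = ω) (hγ' : ¬ ∃ c : ℝ, deriv γ 0 = c • ω) :
    ((∃ δ : ℝ, 0 < δ ∧ ∀ α : ℝ, 0 < α → α < δ →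
        (1 - α) • ω ∈ antipolar Ω ∧ γ (-α) ∈ antipolar Ω ∧
          γ α ∈ antipolar Ω) →
      ω ∈ interior (antipolar Ω)) ∧
    ((¬ ∃ δ : ℝ, 0 < δ ∧ ∀ α : ℝ, 0 < α → α < δ →
        (1 - α) • ω ∈ antipolar Ω ∧ γ (-α) ∈ antipolar Ω ∧
          γ α ∈ antipolar Ω) →
      ω ∈ frontier (antipolar Ω)) := by
  have h0 : Ioo (-1 : ℝ) 1 ∈ nhds (0 : ℝ) := Ioo_mem_nhds (by norm_num) (by norm_num)
  have hd : HasDerivAt γ (deriv γ 0) 0 :=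
    ((hγ.contDiffAt h0).differentiableAt (by norm_num)).hasDerivAt
  constructor
  · rintro ⟨δ, hδ, H⟩
    obtain ⟨xy, hxy⟩ := hΩ.1
    have hn : 0 < ω.1 ^ 2 + ω.2 ^ 2 := by
      by_contra hcon
      have e1 : ω.1 = 0 := by nlinarith [sq_nonneg ω.1, sq_nonneg ω.2]
      have e2 : ω.2 = 0 := by nlinarith [sq_nonneg ω.1, sq_nonneg ω.2]
      have := hω xy hxy
      rw [e1, e2] at this
      norm_num at this
    set v := deriv γ 0 with hv
    have hD : ω.1 * v.2 - ω.2 * v.1 ≠ 0 := by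
      intro hD
      apply hγ'
      refine ⟨(v.1 * ω.1 + v.2 * ω.2) / (ω.1 ^ 2 + ω.2 ^ 2), ?_⟩
      ext
      · simp only [Prod.smul_fst, smul_eq_mul]
        field_simp
        linear_combination (-ω.2) * hD
      · simp only [Prod.smul_snd, smul_eq_mul]
        field_simp
        linear_combination ω.1 * hD
    set D := ω.1 * v.2 - ω.2 * v.1 with hDdef
    have hf1 : HasDerivAt (fun a => (γ a).1) v.1 0 :=
      (hasFDerivAt_fst (𝕜 := ℝ) (p := γ 0)).comp_hasDerivAt (0 : ℝ) hd
    have hf2 : HasDerivAt (fun a => (γ a).2) v.2 0 :=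
      (hasFDerivAt_snd (𝕜 := ℝ) (p := γ 0)).comp_hasDerivAt (0 : ℝ) hd
    have hf : HasDerivAt (fun a => (ω.1 * (γ a).2 - ω.2 * (γ a).1) * D) (D * D) 0 :=
      ((hf2.const_mul ω.1).sub (hf1.const_mul ω.2)).mul_const D
    have hpos : 0 < D * D := mul_self_pos.2 hD
    have hs := (hasDerivAt_iff_tendsto_slope.1 hf).eventually (lt_mem_nhds hpos)
    rw [eventually_nhdsWithin_iff, Metric.eventually_nhds_iff] at hs
    obtain ⟨ε, hε, hs⟩ := hs
    obtain ⟨a, ha, haδ, haε, ha1⟩ : ∃ a : ℝ, 0 < a ∧ a < δ ∧ a < ε ∧ a < 1 := by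
      refine ⟨min δ (min ε 1) / 2, by positivity, ?_, ?_, ?_⟩
      · have := min_le_left δ (min ε 1); linarith
      · have := (min_le_right δ (min ε 1)).trans (min_le_left _ _); linarith
      · have := (min_le_right δ (min ε 1)).trans (min_le_right _ _); linarith
    obtain ⟨K1, K2, K3⟩ := H a ha haδ
    have z : ω.1 * ω.2 - ω.2 * ω.1 = 0 := by ring
    have s1 := @hs a (by simpa [abs_of_pos ha] using haε) (by simpa using ha.ne')
    have s2 := @hs (-a) (by simpa [abs_of_pos ha] using haε) (by simpa using ha.ne')
    simp only [slope_def_field, hγ0, z, zero_mul, sub_zero] at s1 s2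
    have p1 : 0 < (ω.1 * (γ a).2 - ω.2 * (γ a).1) * D := by
      have := mul_pos s1 ha
      rwa [div_mul_cancel₀ _ ha.ne'] at this
    have p2 : (ω.1 * (γ (-a)).2 - ω.2 * (γ (-a)).1) * D < 0 := by
      have := mul_pos s2 ha
      rw [div_neg, neg_mul, div_mul_cancel₀ _ ha.ne'] at this
      linarith
    rcases lt_or_gt_of_ne hD with hneg | hpD
    · exact antipolar_interior_aux Ω ω (γ (-a)) (γ a) (1 - a) (by linarith) hn K1 hω K2 K3
        (pos_of_mul_neg_left p2 hneg.le) (neg_of_mul_pos_left p1 hneg.le)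
    · exact antipolar_interior_aux Ω ω (γ a) (γ (-a)) (1 - a) (by linarith) hn K1 hω K3 K2
        (pos_of_mul_pos_left p1 hpD.le) (neg_of_mul_neg_left p2 hpD.le)
  · intro hno
    refine ⟨subset_closure hω, fun hint => hno ?_⟩
    have hK : antipolar Ω ∈ nhds ω := mem_interior_iff_mem_nhds.1 hint
    have c1 : Filter.Tendsto (fun a : ℝ => (1 - a) • ω) (nhds 0) (nhds ω) := by
      have : Continuous (fun a : ℝ => (1 - a) • ω) := by fun_prop
      simpa using this.tendsto 0
    have c3 : Filter.Tendsto γ (nhds 0) (nhds ω) := by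
      have := hd.continuousAt.tendsto
      rwa [hγ0] at this
    have c2 : Filter.Tendsto (fun a : ℝ => γ (-a)) (nhds 0) (nhds ω) := by
      refine c3.comp ?_
      simpa using (continuous_neg (G := ℝ)).tendsto 0
    have hall := (c1.eventually_mem hK).and ((c2.eventually_mem hK).and (c3.eventually_mem hK))
    rw [Metric.eventually_nhds_iff] at hall
    obtain ⟨ε, hε, hall⟩ := hall
    exact ⟨ε, hε, fun a ha haε => hall (by simpa [abs_of_pos ha] using haε)⟩
end

section
/- Let ν be an anti-norm on ℝ² whose unit ball Ω = {u : ν(u) ≥ 1} satisfies properties (*) and (**), let C = dom ν = closure(ℝ₊Ω), and let h = (h₁,h₂) with (−h₁, h₂) ∈ int Ω^◇. Then the maximum of H(h,u) = h₁u₁ + h₂u₂ + ν(u) over u ∈ C is attained only at u = 0. -/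
open scoped Pointwise

/-- Property (*): no ray from the origin lies on the boundary of `Ω`,
i.e. `λΩ ∩ ∂Ω = ∅` for all `λ > 1`. -/
def PropStar (Ω : Set (ℝ × ℝ)) : Prop :=
  ∀ c : ℝ, 1 < c → (c • Ω) ∩ frontier Ω = ∅

/-- The closed cone generated by `Ω`: `C = closure(ℝ₊Ω)`. -/
def posCone (Ω : Set (ℝ × ℝ)) : Set (ℝ × ℝ) :=
  closure {x | ∃ t : ℝ, 0 ≤ t ∧ ∃ ω ∈ Ω, x = t • ω}

/-- `e` is a direction of a boundary ray of `C`: `e ≠ 0` and the whole ray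
`ℝ₊ e` is contained in the frontier of `C`. -/
def IsBoundaryRayDir (C : Set (ℝ × ℝ)) (e : ℝ × ℝ) : Prop :=
  e ≠ 0 ∧ ∀ t : ℝ, 0 ≤ t → t • e ∈ frontier C

/-- Property (**): the boundary `∂Ω` comes arbitrarily close to each boundary
ray of the cone `C = closure(ℝ₊Ω)`, i.e. `dist(l₀, Ω) = dist(l₁, Ω) = 0`. -/
def PropSS (Ω : Set (ℝ × ℝ)) : Prop :=
  ∀ e : ℝ × ℝ, IsBoundaryRayDir (posCone Ω) e →
    ∀ ε : ℝ, 0 < ε → ∃ t : ℝ, 0 ≤ t ∧ ∃ b ∈ Ω, dist (t • e) b < ε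

/-- An anti-norm on a real normed space `E`: a function `ν : E → ℝ ∪ {−∞}`
(encoded as an `EReal`-valued function never equal to `+∞`) that is concave,
upper semicontinuous (closed hypograph), positively homogeneous, has nonempty
effective domain, and is positive on the relative interior of its domain. -/
structure IsAntinorm {E : Type*} [NormedAddCommGroup E] [NormedSpace ℝ E]
    (ν : E → EReal) : Prop where
  ne_top : ∀ ξ, ν ξ ≠ ⊤
  concave : ∀ ξ η : E, ∀ a b : ℝ, 0 ≤ a → 0 ≤ b → a + b = 1 →
    (a : EReal) * ν ξ + (b : EReal) * ν η ≤ ν (a • ξ + b • η)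
  closed_hypograph : IsClosed {p : E × ℝ | (p.2 : EReal) ≤ ν p.1}
  pos_homog : ∀ c : ℝ, 0 ≤ c → ∀ ξ : E, ν (c • ξ) = (c : EReal) * ν ξ
  dom_nonempty : {ξ : E | ν ξ ≠ ⊥}.Nonempty
  pos_on_ri : ∀ ξ ∈ intrinsicInterior ℝ {ξ : E | ν ξ ≠ ⊥}, 0 < ν ξ

/-- The effective domain of an anti-norm is convex. -/
lemma antinorm_dom_convex {ν : ℝ × ℝ → EReal} (hν : IsAntinorm ν) :
    Convex ℝ {u : ℝ × ℝ | ν u ≠ ⊥} := by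
  intro x hx y hy a b ha hb hab hbot
  have hc := hν.concave x y a b ha hb hab
  lift ν x to ℝ using ⟨hν.ne_top x, hx⟩ with r hr
  lift ν y to ℝ using ⟨hν.ne_top y, hy⟩ with q hq
  rw [hbot, le_bot_iff, ← EReal.coe_mul, ← EReal.coe_mul, ← EReal.coe_add] at hc
  exact EReal.coe_ne_bot _ hc

/-- Moving from a point of a convex set towards a relative interior point. -/
lemma segment_mem_ri {s : Set (ℝ × ℝ)} (hs : Convex ℝ s) {u v : ℝ × ℝ} (hu : u ∈ s)
    (hv : v ∈ intrinsicInterior ℝ s) {t : ℝ} (ht0 : 0 < t) (ht1 : t ≤ 1) :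
    (1 - t) • u + t • v ∈ intrinsicInterior ℝ s := by
  rw [mem_intrinsicInterior] at hv ⊢
  obtain ⟨v', hv', rfl⟩ := hv
  rw [mem_interior_iff_mem_nhds, Metric.mem_nhds_iff] at hv'
  obtain ⟨δ, hδ, hball⟩ := hv'
  have huS : u ∈ affineSpan ℝ s := subset_affineSpan ℝ s hu
  have hw : (1 - t) • u + t • (v' : ℝ × ℝ) ∈ affineSpan ℝ s := by
    have := AffineMap.lineMap_mem t huS v'.2
    rwa [AffineMap.lineMap_apply_module] at this
  refine ⟨⟨_, hw⟩, ?_, rfl⟩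
  rw [mem_interior_iff_mem_nhds, Metric.mem_nhds_iff]
  refine ⟨t * δ, by positivity, ?_⟩
  rintro ⟨y, hy⟩ hyb
  rw [Metric.mem_ball, Subtype.dist_eq, dist_eq_norm] at hyb
  simp only at hyb
  set w := (1 - t) • u + t • (v' : ℝ × ℝ) with hwdef
  have hz : t⁻¹ • (y - w) + (v' : ℝ × ℝ) ∈ affineSpan ℝ s :=
    AffineSubspace.vadd_mem_of_mem_direction
      (Submodule.smul_mem _ _ (AffineSubspace.vsub_mem_direction hy hw)) v'.2
  have hzs : (⟨_, hz⟩ : affineSpan ℝ s) ∈ ((↑) ⁻¹' s : Set (affineSpan ℝ s)) := by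
    apply hball
    rw [Metric.mem_ball, Subtype.dist_eq, dist_eq_norm]
    simp only [add_sub_cancel_right, norm_smul, norm_inv, Real.norm_eq_abs, abs_of_pos ht0]
    rwa [inv_mul_lt_iff₀ ht0]
  have := hs hu hzs (by linarith : 0 ≤ 1 - t) ht0.le (by ring)
  have e : (1 - t) • u + t • (t⁻¹ • (y - w) + (v' : ℝ × ℝ)) = y := by
    rw [smul_add, smul_smul, mul_inv_cancel₀ ht0.ne', one_smul, hwdef]; abel
  rw [e] at this
  exact this

/-- Interior points of the antipolar give a strict, uniform estimate. -/
lemma antipolar_interior_bound {Ω : Set (ℝ × ℝ)} {h : ℝ × ℝ}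
    (hint : (-h.1, h.2) ∈ interior (antipolar Ω)) :
    ∃ ε > 0, ∀ x ∈ Ω, 1 + ε * (|x.1| + |x.2|) ≤ -(h.1 * x.1 + h.2 * x.2) := by
  rw [mem_interior_iff_mem_nhds, Metric.mem_nhds_iff] at hint
  obtain ⟨δ, hδ, hb⟩ := hint
  refine ⟨δ / 2, by positivity, fun x hx => ?_⟩
  have key : ∀ a b : ℝ, |a| ≤ 1 → |b| ≤ 1 →
      1 ≤ (-h.1 + δ / 2 * a) * x.1 - (h.2 + δ / 2 * b) * x.2 := by
    intro a b ha hb'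
    have hm : (-h.1 + δ / 2 * a, h.2 + δ / 2 * b) ∈ antipolar Ω := by
      apply hb
      rw [Metric.mem_ball, Prod.dist_eq, max_lt_iff, Real.dist_eq, Real.dist_eq]
      simp only [add_sub_cancel_left, abs_mul, abs_of_pos (half_pos hδ)]
      constructor <;> nlinarith
    exact hm x hx
  have s1 : ∀ y : ℝ, ∃ a : ℝ, |a| ≤ 1 ∧ a * y = -|y| := by
    intro y
    rcases le_total 0 y with hy | hy
    · exact ⟨-1, by norm_num, by rw [abs_of_nonneg hy]; ring⟩
    · exact ⟨1, by norm_num, by rw [abs_of_nonpos hy]; ring⟩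
  obtain ⟨a, ha, hax⟩ := s1 x.1
  obtain ⟨b, hb1, hbx⟩ := s1 x.2
  have := key a (-b) ha (by rwa [abs_neg])
  have e : (-h.1 + δ / 2 * a) * x.1 - (h.2 + δ / 2 * (-b)) * x.2
      = -(h.1 * x.1 + h.2 * x.2) + δ / 2 * (a * x.1 + b * x.2) := by ring
  rw [e, hax, hbx] at this
  linarith

/-- The key strict inequality. -/
lemma antinorm_key {ν : ℝ × ℝ → EReal} (hν : IsAntinorm ν) (h : ℝ × ℝ)
    (hint : (-h.1, h.2) ∈ interior (antipolar {u : ℝ × ℝ | 1 ≤ ν u}))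
    (u : ℝ × ℝ) (hu : ν u ≠ ⊥) (hu0 : u ≠ 0) :
    ((h.1 * u.1 + h.2 * u.2 : ℝ) : EReal) + ν u < 0 := by
  obtain ⟨ε, hε, hb⟩ := antipolar_interior_bound hint
  have pos : ∀ x : ℝ × ℝ, ∀ r : ℝ, 0 < r → ν x = r →
      r + ε * (|x.1| + |x.2|) ≤ -(h.1 * x.1 + h.2 * x.2) := by
    intro x r hr hx
    have hm : r⁻¹ • x ∈ {u : ℝ × ℝ | 1 ≤ ν u} := by
      rw [Set.mem_ofPred_eq, hν.pos_homog _ (by positivity), hx, ← EReal.coe_mul,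
        inv_mul_cancel₀ hr.ne', EReal.coe_one]
    have := hb _ hm
    simp only [Prod.smul_fst, Prod.smul_snd, smul_eq_mul, abs_mul, abs_inv, abs_of_pos hr] at this
    have h2 := mul_le_mul_of_nonneg_left this hr.le
    have e1 : r * (1 + ε * (r⁻¹ * |x.1| + r⁻¹ * |x.2|)) = r + ε * (|x.1| + |x.2|) := by
      field_simp
    have e2 : r * (-(h.1 * (r⁻¹ * x.1) + h.2 * (r⁻¹ * x.2))) = -(h.1 * x.1 + h.2 * x.2) := by
      field_simp
    rwa [e1, e2] at h2
  have hconv := antinorm_dom_convex hν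
  obtain ⟨v, hv⟩ := hν.dom_nonempty.intrinsicInterior hconv
  have hseg : ∀ t : ℝ, t ∈ Set.Ioc (0 : ℝ) 1 →
      ε * (|((1 - t) • u + t • v).1| + |((1 - t) • u + t • v).2|) ≤
        -(h.1 * ((1 - t) • u + t • v).1 + h.2 * ((1 - t) • u + t • v).2) := by
    intro t ht
    have hri := segment_mem_ri hconv hu hv ht.1 ht.2
    have hp := hν.pos_on_ri _ hri
    have hnb : ν ((1 - t) • u + t • v) ≠ ⊥ := intrinsicInterior_subset hri
    obtain ⟨r, hr⟩ : ∃ r : ℝ, ν ((1 - t) • u + t • v) = r :=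
      ⟨_, (EReal.coe_toReal (hν.ne_top _) hnb).symm⟩
    rw [hr] at hp
    have hr0 : 0 < r := by exact_mod_cast hp
    linarith [pos _ r hr0 hr]
  have hlim : ε * (|u.1| + |u.2|) ≤ -(h.1 * u.1 + h.2 * u.2) := by
    have hcl : (0 : ℝ) ∈ closure (Set.Ioc (0 : ℝ) 1) := by
      rw [closure_Ioc (by norm_num)]; simp
    have hclosed : IsClosed {t : ℝ |
        ε * (|((1 - t) • u + t • v).1| + |((1 - t) • u + t • v).2|) ≤
        -(h.1 * ((1 - t) • u + t • v).1 + h.2 * ((1 - t) • u + t • v).2)} :=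
      isClosed_le (by fun_prop) (by fun_prop)
    have : ε * (|((1 - (0 : ℝ)) • u + (0 : ℝ) • v).1| + |((1 - (0 : ℝ)) • u + (0 : ℝ) • v).2|) ≤
        -(h.1 * ((1 - (0 : ℝ)) • u + (0 : ℝ) • v).1 +
          h.2 * ((1 - (0 : ℝ)) • u + (0 : ℝ) • v).2) :=
      closure_minimal (s := Set.Ioc (0 : ℝ) 1) (fun t ht => hseg t ht) hclosed hcl
    simpa only [sub_zero, one_smul, zero_smul, add_zero] using this
  have hupos : 0 < |u.1| + |u.2| := by
    by_contra hc
    apply hu0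
    have h1 := abs_nonneg u.1
    have h2 := abs_nonneg u.2
    exact Prod.ext (abs_eq_zero.1 (by linarith)) (abs_eq_zero.1 (by linarith))
  have hprod := mul_pos hε hupos
  obtain ⟨r, hr⟩ : ∃ r : ℝ, ν u = r := ⟨_, (EReal.coe_toReal (hν.ne_top _) hu).symm⟩
  rw [hr, ← EReal.coe_add, ← EReal.coe_zero, EReal.coe_lt_coe_iff]
  rcases lt_or_ge 0 r with hr0 | hr0
  · linarith [pos u r hr0 hr]
  · linarith

/-- Let `ν` be an anti-norm on `ℝ²` whose unit ball `Ω = {u : ν(u) ≥ 1}`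
satisfies properties (*) and (**), let `C = dom ν`, and let `h = (h₁,h₂)` with
`(−h₁, h₂) ∈ int Ω^◇`.  Then the maximum of `H(h,u) = h₁u₁ + h₂u₂ + ν(u)`
over `u ∈ C` is attained only at `u = 0`. -/
theorem max_attained_only_at_zero
    (ν : ℝ × ℝ → EReal) (hν : IsAntinorm ν)
    (hstar : PropStar {u : ℝ × ℝ | 1 ≤ ν u})
    (hss : PropSS {u : ℝ × ℝ | 1 ≤ ν u})
    (h : ℝ × ℝ)
    (hint : (-h.1, h.2) ∈ interior (antipolar {u : ℝ × ℝ | 1 ≤ ν u}))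
    (C : Set (ℝ × ℝ)) (hC : C = {u : ℝ × ℝ | ν u ≠ ⊥})
    (H : ℝ × ℝ → EReal)
    (hH : ∀ u : ℝ × ℝ, H u = ((h.1 * u.1 + h.2 * u.2 : ℝ) : EReal) + ν u) :
    (∀ u ∈ C, H u ≤ H 0) ∧ (∀ u ∈ C, H u = H 0 → u = 0) := by
  have h0 : H 0 = 0 := by
    have := hν.pos_homog 0 le_rfl 0
    rw [hH]
    simp only [zero_smul, EReal.coe_zero, zero_mul] at this
    simp [this]
  have key : ∀ u ∈ C, u ≠ 0 → H u < H 0 := by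
    intro u hu hu0
    rw [h0, hH]
    rw [hC] at hu
    exact antinorm_key hν h hint u hu hu0
  refine ⟨fun u hu => ?_, fun u hu he => ?_⟩
  · by_cases hu0 : u = 0
    · rw [hu0]
    · exact (key u hu hu0).le
  · by_contra hu0
    exact (key u hu hu0).ne he
end
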